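/- Let R ∈ H₀ be a local ring with maximal ideal M such that the integral closure R' of R in its total quotient ring is a Prüfer ring. Let T be an overring of R. Then Spec(R) = Spec(T) if and only if M is a prime ideal of T. -/

import Mathlib

/-- A subset `S` of a ring `A` is (the underlying set of) a prime ideal of the subring `B`. -/
def IsPrimeIdealSetOf {A : Type*} [CommRing A] (B : Subring A) (S : Set A) : Prop :=
  ∃ I : Ideal B, I.IsPrime ∧ Subtype.val '' (I : Set B) = S

/-- `Spec(R) = Spec(T)` for a subring `R` of `T`: a subset of `T` is a prime ideal of `T`
iff it is a prime ideal of `R`. -/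
def SpecEq {T : Type*} [CommRing T] (R : Subring T) : Prop :=
  ∀ S : Set T, (∃ J : Ideal T, J.IsPrime ∧ (J : Set T) = S) ↔ IsPrimeIdealSetOf R S
/-- `Spec` equality between two subrings of a common ring: a subset is a prime ideal of `R`
iff it is a prime ideal of `T`. -/
def SpecEqSub {A : Type*} [CommRing A] (R T : Subring A) : Prop :=
  ∀ S : Set A, IsPrimeIdealSetOf R S ↔ IsPrimeIdealSetOf T S
/-- An ideal `P` of `R` is divided if it is comparable with every ideal of `R`. -/
def Ideal.IsDivided {R : Type*} [CommRing R] (P : Ideal R) : Prop :=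
  ∀ I : Ideal R, I ≤ P ∨ P ≤ I

/-- `R ∈ H` : the nilradical of `R` is a divided prime ideal. -/
def MemH (R : Type*) [CommRing R] : Prop :=
  (nilradical R).IsPrime ∧ (nilradical R).IsDivided
/-- `R ∈ H₀` : `R ∈ H` and `Nil(R) = Z(R)` (the nilradical is the set of
zero-divisors). -/
def MemH0 (R : Type*) [CommRing R] : Prop :=
  MemH R ∧ (nilradical R : Set R) = {x : R | x ∉ nonZeroDivisors R}
/-- A Prüfer ring: every finitely generated ideal containing a non-zero-divisor is
invertible (as a fractional ideal in the total quotient ring). -/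
def IsPruferRing (A : Type*) [CommRing A] : Prop :=
  ∀ I : Ideal A, I.FG → (∃ x ∈ I, x ∈ nonZeroDivisors A) →
    ∃ J : FractionalIdeal (nonZeroDivisors A) (FractionRing A),
      (I : FractionalIdeal (nonZeroDivisors A) (FractionRing A)) * J = 1

/-- In a Prüfer ring, two elements `a, b` with `b` a non-zero-divisor are locally comparable:
the algebraic form of the invertibility of the ideal `(a, b)`. -/
theorem IsPruferRing.exists_add_eq_one {A : Type*} [CommRing A] (hA : IsPruferRing A)
    (a b : A) (hb : b ∈ nonZeroDivisors A) :
    ∃ e y w : A, e * a = w * b ∧ y * a = (1 - e) * b := by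
  obtain ⟨J, hJ⟩ := hA (Ideal.span {a} ⊔ Ideal.span {b})
    (Submodule.FG.sup ⟨{a}, by simp [Ideal.span]⟩ ⟨{b}, by simp [Ideal.span]⟩)
    ⟨b, Ideal.mem_sup_right (Ideal.mem_span_singleton_self b), hb⟩
  have key : ∀ c ∈ Ideal.span {a} ⊔ Ideal.span {b}, ∀ u ∈ J,
      ∃ z : A, algebraMap A (FractionRing A) z = algebraMap A (FractionRing A) c * u := by
    intro c hc u hu
    have h := FractionalIdeal.mul_mem_mul
      (FractionalIdeal.mem_coeIdeal_of_mem (nonZeroDivisors A) hc) hu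
    rw [hJ] at h
    exact (FractionalIdeal.mem_one_iff _).1 h
  have ha' : a ∈ Ideal.span {a} ⊔ Ideal.span {b} :=
    Ideal.mem_sup_left (Ideal.mem_span_singleton_self a)
  have hb' : b ∈ Ideal.span {a} ⊔ Ideal.span {b} :=
    Ideal.mem_sup_right (Ideal.mem_span_singleton_self b)
  have h1 : (1 : FractionRing A) ∈
      (1 : FractionalIdeal (nonZeroDivisors A) (FractionRing A)) :=
    FractionalIdeal.one_mem_one _
  rw [← hJ, FractionalIdeal.coeIdeal_sup, add_mul,
    FractionalIdeal.mem_add] at h1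
  obtain ⟨p, hp, q, hq, hpq⟩ := h1
  rw [FractionalIdeal.coeIdeal_span_singleton, FractionalIdeal.mem_singleton_mul] at hp hq
  obtain ⟨u, hu, rfl⟩ := hp
  obtain ⟨v, hv, rfl⟩ := hq
  obtain ⟨e, he⟩ := key b hb' v hv
  obtain ⟨y, hy⟩ := key b hb' u hu
  obtain ⟨w, hw⟩ := key a ha' v hv
  refine ⟨e, y, w, ?_, ?_⟩ <;> apply IsFractionRing.injective A (FractionRing A)
  · simp only [map_mul, he, hw]; ring
  · simp only [map_mul, map_sub, map_one, he, hy, ← hpq]; ring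

/-- In a domain over a field, a nonzero integral element has an integral inverse. -/
theorem IsIntegral.exists_mul_eq_one {k L : Type*} [Field k] [CommRing L] [IsDomain L]
    [Algebra k L] {x : L} (hx : IsIntegral k x) (h0 : x ≠ 0) :
    ∃ z : L, IsIntegral k z ∧ x * z = 1 := by
  have hF : IsField (integralClosure k L) := isField_of_isIntegral_of_isField' (Field.toIsField k)
  obtain ⟨z, hz⟩ := hF.mul_inv_cancel (a := ⟨x, hx⟩) (fun h => h0 (congrArg Subtype.val h))
  exact ⟨z, z.2, congrArg Subtype.val hz⟩

theorem isIntegral_of_add_mul_eq_one {k L : Type*} [Field k] [CommRing L] [IsDomain L]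
    [Algebra k L] {e y t : L} (he : IsIntegral k e) (hy : IsIntegral k y)
    (het : IsIntegral k (e * t)) (h : e + y * t = 1) : IsIntegral k t := by
  by_cases h0 : e = 0
  · obtain ⟨z, hz, hyz⟩ := hy.exists_mul_eq_one (fun hy0 => by simp [h0, hy0] at h)
    have : t = z := by linear_combination z * h - t * hyz - z * h0
    exact this ▸ hz
  · obtain ⟨z, hz, hez⟩ := he.exists_mul_eq_one h0
    have : t = e * t * z := by linear_combination -t * hez
    exact this ▸ het.mul hz

/-- Let `Q` be a prime of an intermediate ring `T` of `R → K` lying over the maximal ideal of `R`.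
If every `t ∈ T` is locally integral or inverse to an integral element, then `Q` is maximal. -/
theorem isMaximal_of_integralClosure {R K : Type*} [CommRing R] [IsLocalRing R] [CommRing K]
    [Algebra R K] (T : Subring K) (hT : (algebraMap R K).range ≤ T)
    (H : ∀ t ∈ T, ∃ e y : K, IsIntegral R e ∧ IsIntegral R y ∧ IsIntegral R (e * t) ∧
      e + y * t = 1)
    (Q : Ideal T) [Q.IsPrime]
    (hQ : ∀ x ∈ IsLocalRing.maximalIdeal R, ∀ hx : algebraMap R K x ∈ T,
      (⟨algebraMap R K x, hx⟩ : T) ∈ Q) : Q.IsMaximal := by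
  let φ : R →+* T := (algebraMap R K).codRestrict T fun x => hT ⟨x, rfl⟩
  let T' := integralClosure T K
  obtain ⟨Q', -, hQ'p, hQ'⟩ := Ideal.exists_ideal_over_prime_of_isIntegral (S := T') Q ⊥
    (fun x hx => by
      have h1 : algebraMap T T' x = 0 := hx
      have h2 : (x : K) = 0 := congrArg Subtype.val h1
      have h3 : x = 0 := Subtype.ext h2
      rw [h3]; exact Q.zero_mem)
  let k := R ⧸ IsLocalRing.maximalIdeal R
  let : Field k := Ideal.Quotient.field _
  let f : k →+* T ⧸ Q := Ideal.Quotient.lift _ ((Ideal.Quotient.mk Q).comp φ)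
    fun x hx => Ideal.Quotient.eq_zero_iff_mem.2 (hQ x hx _)
  let g : T ⧸ Q →+* T' ⧸ Q' := Ideal.quotientMap Q' (algebraMap T T') hQ'.ge
  have hg : Function.Injective g := Ideal.quotientMap_injective' hQ'.le
  let : Algebra k (T ⧸ Q) := f.toAlgebra
  let : Algebra k (T' ⧸ Q') := (g.comp f).toAlgebra
  let G : T ⧸ Q →ₐ[k] T' ⧸ Q' := { g with commutes' := fun _ => rfl }
  have mem : ∀ x : K, IsIntegral R x → x ∈ T' := by
    rintro x ⟨p, hp, hpx⟩
    refine ⟨p.map φ, hp.map φ, ?_⟩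
    rw [Polynomial.eval₂_map]
    exact hpx
  have int : ∀ (x : K) (hx : IsIntegral R x),
      IsIntegral k (Ideal.Quotient.mk Q' ⟨x, mem x hx⟩) := by
    intro x hx
    obtain ⟨p, hp, hpx⟩ := id hx
    refine ⟨p.map (Ideal.Quotient.mk _), hp.map _, ?_⟩
    have h1 : Polynomial.eval₂ ((algebraMap T T').comp φ) ⟨x, mem x hx⟩ p = 0 := by
      apply Subtype.val_injective
      have := Polynomial.hom_eval₂ p ((algebraMap T T').comp φ) T'.val.toRingHom ⟨x, mem x hx⟩
      exact this.trans hpx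
    have h2 := congrArg (Ideal.Quotient.mk Q') h1
    rw [Polynomial.hom_eval₂, map_zero] at h2
    rw [Polynomial.eval₂_map]
    exact h2
  have hint : Algebra.IsIntegral k (T ⧸ Q) := by
    refine ⟨fun x => ?_⟩
    obtain ⟨t, rfl⟩ := Ideal.Quotient.mk_surjective x
    rw [← isIntegral_algHom_iff G hg]
    obtain ⟨e, y, he, hy, het, h⟩ := H t t.2
    refine isIntegral_of_add_mul_eq_one (int e he) (int y hy) ?_ ?_
    · exact int _ het
    · exact congrArg (Ideal.Quotient.mk Q')
        (Subtype.ext h : (⟨e, mem e he⟩ + ⟨y, mem y hy⟩ * algebraMap T T' t : T') = 1)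
  exact Ideal.Quotient.maximal_of_isField _
    (isField_of_isIntegral_of_isField' (R := k) (Field.toIsField k))

/-- If `R ⊆ T` and the maximal ideal of the local ring `R` is also a maximal ideal of `T`, then
`R` and `T` have the same prime ideals. -/
theorem specEqSub_of_isMaximal {A : Type*} [CommRing A] (R T : Subring A) [IsLocalRing R]
    (hRT : R ≤ T) (Q : Ideal T) [Q.IsMaximal]
    (hQ : Subtype.val '' (Q : Set T) =
      Subtype.val '' (IsLocalRing.maximalIdeal R : Set R)) : SpecEqSub R T := by
  have mem_iff : ∀ (x : A) (hR : x ∈ R), (⟨x, hRT hR⟩ : T) ∈ Q ↔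
      (⟨x, hR⟩ : R) ∈ IsLocalRing.maximalIdeal R := fun x hR => by
    have := Set.ext_iff.1 hQ x
    simpa [hR, hRT hR] using this
  have mem_R : ∀ x : T, x ∈ Q → (x : A) ∈ R := fun x hx => by
    obtain ⟨y, -, hy⟩ := hQ.subset ⟨x, hx, rfl⟩
    exact hy ▸ y.2
  have unit : ∀ x : T, x ∉ Q → IsUnit x := by
    intro x hx
    obtain ⟨z, hz⟩ := Ideal.Quotient.exists_inv (I := Q)
      (a := Ideal.Quotient.mk Q x) (by rwa [Ne, Ideal.Quotient.eq_zero_iff_mem])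
    obtain ⟨z, rfl⟩ := Ideal.Quotient.mk_surjective z
    rw [← map_mul, ← map_one (Ideal.Quotient.mk Q), Ideal.Quotient.eq] at hz
    have hR := mem_R _ hz
    have hm := (mem_iff _ hR).1 hz
    have hu := (IsLocalRing.isUnit_or_isUnit_one_sub_self (-(⟨_, hR⟩ : R))).resolve_left
      ((IsLocalRing.mem_maximalIdeal _).1 (neg_mem hm))
    have hu' := hu.map (Subring.inclusion hRT)
    refine isUnit_of_mul_isUnit_left (y := z) (?_ : IsUnit (x * z))
    convert hu' using 1
    apply Subtype.ext
    simp
  intro S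
  constructor
  · rintro ⟨P, hP, rfl⟩
    have hPM : P ≤ IsLocalRing.maximalIdeal R := IsLocalRing.le_maximalIdeal hP.ne_top
    by_cases hPe : P = IsLocalRing.maximalIdeal R
    · exact ⟨Q, inferInstance, by rw [hQ, hPe]⟩
    obtain ⟨m, hm, hmP⟩ := SetLike.exists_of_lt (lt_of_le_of_ne hPM hPe)
    have hPQ : ∀ p : R, p ∈ P → Subring.inclusion hRT p ∈ Q := fun p hp =>
      (mem_iff p p.2).2 (hPM hp)
    let I : Ideal T :=
      { carrier := {x | ∃ h : (x : A) ∈ R, (⟨x, h⟩ : R) ∈ P}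
        zero_mem' := ⟨R.zero_mem, P.zero_mem⟩
        add_mem' := fun ⟨h, hx⟩ ⟨h', hy⟩ => ⟨R.add_mem h h', P.add_mem hx hy⟩
        smul_mem' := by
          rintro t x ⟨h, hx⟩
          have htx : (t * x : T).1 ∈ R := mem_R _ (Q.mul_mem_left t (hPQ _ hx))
          have htm : (t * Subring.inclusion hRT m : T).1 ∈ R :=
            mem_R _ (Q.mul_mem_left t ((mem_iff m m.2).2 hm))
          refine ⟨htx, (hP.mem_or_mem (y := m) ?_).resolve_right hmP⟩
          have : (⟨_, htx⟩ * m : R) = ⟨_, htm⟩ * ⟨x, h⟩ := by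
            apply Subtype.ext
            simp only [Subring.coe_mul, Subring.coe_inclusion]
            ring
          change (⟨_, htx⟩ * m : R) ∈ P
          rw [this]
          exact P.mul_mem_left _ hx }
    refine ⟨I, ⟨?_, ?_⟩, ?_⟩
    · rw [Ideal.ne_top_iff_one]
      rintro ⟨h, h1⟩
      exact hP.ne_top ((Ideal.eq_top_iff_one P).2 h1)
    · intro a b hab
      by_cases ha : a ∈ Q
      · by_cases hb : b ∈ Q
        · obtain ⟨h, hab⟩ := hab
          exact (hP.mem_or_mem (x := ⟨a, mem_R a ha⟩) (y := ⟨b, mem_R b hb⟩) hab).imp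
            (fun h => ⟨_, h⟩) (fun h => ⟨_, h⟩)
        · exact Or.inl ((Ideal.mul_unit_mem_iff_mem I (unit b hb)).1 hab)
      · exact Or.inr ((Ideal.unit_mul_mem_iff_mem I (unit a ha)).1 hab)
    · ext x
      constructor
      · rintro ⟨x, ⟨h, hx⟩, rfl⟩
        exact ⟨_, hx, rfl⟩
      · rintro ⟨x, hx, rfl⟩
        exact ⟨⟨x, hRT x.2⟩, ⟨x.2, hx⟩, rfl⟩
  · rintro ⟨P, hP, rfl⟩
    have hPQ : P ≤ Q := fun x hx => by
      by_contra h
      exact hP.ne_top (Ideal.eq_top_of_isUnit_mem P hx (unit x h))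
    refine ⟨P.comap (Subring.inclusion hRT), inferInstance, ?_⟩
    ext x
    constructor
    · rintro ⟨x, hx, rfl⟩
      exact ⟨_, hx, rfl⟩
    · rintro ⟨x, hx, rfl⟩
      exact ⟨⟨x, mem_R x (hPQ hx)⟩, hx, rfl⟩

open IsLocalRing in
/-- Let `R ∈ H₀` be a local ring with maximal ideal `M` whose integral
closure `R'` in `T(R)` is a Prüfer ring, and let `T` be an overring of `R`.  Then
`Spec(R) = Spec(T)` iff `M` is a prime ideal of `T`. -/
theorem stmt11 {R : Type*} [CommRing R] [IsLocalRing R] (h0 : MemH0 R)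
    (hPruf : IsPruferRing ↥(integralClosure R (FractionRing R)))
    (T : Subring (FractionRing R)) (hT : (algebraMap R (FractionRing R)).range ≤ T) :
    SpecEqSub (algebraMap R (FractionRing R)).range T ↔
      ∃ Q : Ideal ↥T, Q.IsPrime ∧
        Subtype.val '' (Q : Set ↥T) =
          algebraMap R (FractionRing R) '' (maximalIdeal R : Set R) := by
  let φ := algebraMap R (FractionRing R)
  have hφ : Function.Injective φ := IsFractionRing.injective R (FractionRing R)
  have hloc : IsLocalRing φ.range := IsLocalRing.of_surjective' φ.rangeRestrict
    φ.rangeRestrict_surjective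
  have hmax : Subtype.val '' (maximalIdeal φ.range : Set φ.range) =
      φ '' (maximalIdeal R : Set R) := by
    have hinj : Function.Injective φ.rangeRestrict := fun x y h => hφ (congrArg Subtype.val h)
    let E := RingEquiv.ofBijective φ.rangeRestrict ⟨hinj, φ.rangeRestrict_surjective⟩
    have hE : ∀ x : R, E x ∈ maximalIdeal φ.range ↔ x ∈ maximalIdeal R := fun x => by
      rw [mem_maximalIdeal, mem_maximalIdeal, mem_nonunits_iff, mem_nonunits_iff,
        MulEquiv.isUnit_map]
    ext z
    constructor
    · rintro ⟨z, hz, rfl⟩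
      obtain ⟨x, rfl⟩ := E.surjective z
      exact ⟨x, (hE x).1 hz, rfl⟩
    · rintro ⟨x, hx, rfl⟩
      exact ⟨E x, (hE x).2 hx, rfl⟩
  constructor
  · intro h
    exact (h _).1 ⟨maximalIdeal φ.range, inferInstance, hmax⟩
  · rintro ⟨Q, hQp, hQ⟩
    have hQm : Q.IsMaximal := by
      refine isMaximal_of_integralClosure T hT (fun t _ => ?_) Q (fun x hx _ => ?_)
      · obtain ⟨⟨a, b⟩, hab⟩ := IsLocalization.surj (nonZeroDivisors R) t
        have hb : IsUnit (φ b) := IsLocalization.map_units _ b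
        obtain ⟨e, y, w, hw, hy⟩ := hPruf.exists_add_eq_one
          (algebraMap R _ a) (algebraMap R _ b) (mem_nonZeroDivisors_of_injective
            (f := (integralClosure R (FractionRing R)).val) Subtype.val_injective
            hb.mem_nonZeroDivisors)
        have hw' : (e : FractionRing R) * φ a = w * φ b := congrArg Subtype.val hw
        have hy' : (y : FractionRing R) * φ a = (1 - e) * φ b := congrArg Subtype.val hy
        have het : (e : FractionRing R) * t = w :=
          hb.mul_right_cancel (by rw [mul_assoc, hab, hw'])
        have hyt : (y : FractionRing R) * t = 1 - e :=
          hb.mul_right_cancel (by rw [mul_assoc, hab, hy'])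
        exact ⟨e, y, e.2, y.2, het ▸ w.2, by rw [hyt]; ring⟩
      · obtain ⟨z, hz, hzx⟩ := hQ.superset ⟨x, hx, rfl⟩
        rwa [← show z = ⟨_, _⟩ from Subtype.ext hzx]
    exact specEqSub_of_isMaximal _ T hT Q (hQ.trans hmax.symm)
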